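/- Let y₁, …, y_m ∈ ℝⁿ, let L ⊂ ℝⁿ be a convex body containing 0 in its interior, and set K := {x ∈ ℝⁿ : ⟨x, y_i⟩ ≤ 1 for all i ∈ [m]} ∩ L. Let R > 1 and suppose there exist points x₁, …, x_m ∈ K such that for each i: ⟨x_i, y_i⟩ = 1; ⟨x_i, y_j⟩ ≤ 1/(2R) for every j ≠ i; and ⟨x_i, y⟩ ≤ 1/(2R) for every y ∈ L°. Then every polytope P of the form P = {x ∈ ℝⁿ : ⟨x, w_l⟩ ≤ 1 for l = 1, …, m₁} satisfying K ⊆ P ⊆ R·K must have m₁ ≥ m/(2R). -/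

import Mathlib

open RealInnerProductSpace Pointwise

/-- A convex body: compact, convex, with nonempty interior. -/
def IsConvexBody {n : ℕ} (K : Set (EuclideanSpace ℝ (Fin n))) : Prop :=
  IsCompact K ∧ Convex ℝ K ∧ (interior K).Nonempty

/-- The polar of a set. -/
def polarSet {n : ℕ} (L : Set (EuclideanSpace ℝ (Fin n))) : Set (EuclideanSpace ℝ (Fin n)) :=
  {y | ∀ x ∈ L, ⟪x, y⟫ ≤ 1}

/-- One inclusion of the bipolar theorem. -/
theorem mem_of_inner_polarSet_le_one {n : ℕ} {L : Set (EuclideanSpace ℝ (Fin n))}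
    (hconv : Convex ℝ L) (hclosed : IsClosed L) (h0 : 0 ∈ L) {p : EuclideanSpace ℝ (Fin n)}
    (hp : ∀ z ∈ polarSet L, ⟪p, z⟫ ≤ 1) : p ∈ L := by
  by_contra hpL
  obtain ⟨f, u, hf, hfp⟩ := geometric_hahn_banach_closed_point hconv hclosed hpL
  have hu : 0 < u := by simpa using hf 0 h0
  have hinner (a : EuclideanSpace ℝ (Fin n)) :
      ⟪a, u⁻¹ • (InnerProductSpace.toDual ℝ _).symm f⟫ = f a / u := by
    rw [inner_smul_right, real_inner_comm, InnerProductSpace.toDual_symm_apply,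
      inv_mul_eq_div]
  have h := hp (u⁻¹ • (InnerProductSpace.toDual ℝ _).symm f) fun a ha => by
    rw [hinner, div_le_one hu]
    exact (hf a ha).le
  rw [hinner, div_le_one hu] at h
  exact absurd h (not_le.mpr hfp)

/-- A linear functional bounded by `1` on the body takes values at least `1 / R` on at most `2 * R`
of the points `x i`. -/
theorem card_le_of_inv_le_inner {ι : Type*} {n : ℕ} {y : ι → EuclideanSpace ℝ (Fin n)}
    {L : Set (EuclideanSpace ℝ (Fin n))} (hconv : Convex ℝ L) (hclosed : IsClosed L) (h0 : 0 ∈ L)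
    {R : ℝ} (hR : 0 < R) {x : ι → EuclideanSpace ℝ (Fin n)}
    (hxy : ∀ i, ⟪x i, y i⟫ = 1)
    (hxy' : ∀ i j, i ≠ j → ⟪x i, y j⟫ ≤ 1 / (2 * R))
    (hxL : ∀ i, ∀ z ∈ polarSet L, ⟪x i, z⟫ ≤ 1 / (2 * R))
    {w : EuclideanSpace ℝ (Fin n)}
    (hw : ∀ v ∈ {v | ∀ i, ⟪v, y i⟫ ≤ 1} ∩ L, ⟪v, w⟫ ≤ 1)
    (S : Finset ι) (hS : ∀ i ∈ S, 1 / R ≤ ⟪x i, w⟫) : (S.card : ℝ) ≤ 2 * R := by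
  classical
  set t : ℝ := 1 + S.card * (1 / (2 * R)) with ht
  have htpos : 0 < t := by positivity
  have hinner (z : EuclideanSpace ℝ (Fin n)) :
      ⟪t⁻¹ • ∑ i ∈ S, x i, z⟫ = (∑ i ∈ S, ⟪x i, z⟫) / t := by
    rw [real_inner_smul_left, sum_inner, inv_mul_eq_div]
  have hmem : t⁻¹ • ∑ i ∈ S, x i ∈ {v | ∀ i, ⟪v, y i⟫ ≤ 1} ∩ L := by
    refine ⟨fun j => ?_, mem_of_inner_polarSet_le_one hconv hclosed h0 fun z hz => ?_⟩
    · rw [hinner, div_le_one htpos]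
      calc ∑ i ∈ S, ⟪x i, y j⟫ ≤ ∑ i ∈ S, ((if i = j then 1 else 0) + 1 / (2 * R)) := by
            refine Finset.sum_le_sum fun i _ => ?_
            split_ifs with hij
            · rw [hij, hxy]
              exact le_add_of_nonneg_right (by positivity)
            · simpa using hxy' i j hij
        _ ≤ t := by
            rw [Finset.sum_add_distrib, Finset.sum_ite_eq', Finset.sum_const, nsmul_eq_mul, ht]
            gcongr
            split_ifs <;> norm_num
    · rw [hinner, div_le_one htpos]
      have := Finset.sum_le_card_nsmul S _ _ fun i _ => hxL i z hz
      rw [nsmul_eq_mul] at this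
      linarith
  have hle := hw _ hmem
  rw [hinner, div_le_one htpos] at hle
  have hge := Finset.card_nsmul_le_sum S _ _ hS
  rw [nsmul_eq_mul] at hge
  have h : (S.card : ℝ) * (1 / R) ≤ 1 + S.card * (1 / (2 * R)) := hge.trans hle
  field_simp at h
  linarith

/-- If the polytope defined by the `w l` lies in `R • K`, then every point on a supporting
hyperplane `⟪·, y⟫ = 1` of `K` satisfies `1 / R ≤ ⟪p, w l⟫` for some `l`. -/
theorem exists_inv_le_inner {κ : Type*} [Finite κ] {n : ℕ} {K : Set (EuclideanSpace ℝ (Fin n))}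
    {R : ℝ} (hR : 0 < R) {w : κ → EuclideanSpace ℝ (Fin n)}
    (hw : {x : EuclideanSpace ℝ (Fin n) | ∀ l, ⟪x, w l⟫ ≤ 1} ⊆ R • K)
    {p y : EuclideanSpace ℝ (Fin n)} (hK : ∀ x ∈ K, ⟪x, y⟫ ≤ 1) (hp : ⟪p, y⟫ = 1) :
    ∃ l, 1 / R ≤ ⟪p, w l⟫ := by
  by_contra! hlt
  have hnear : ∀ᶠ s in nhdsWithin R (Set.Ioi R), ∀ l, s * ⟪p, w l⟫ < 1 := by
    refine Filter.eventually_all.mpr fun l => Filter.Eventually.filter_mono nhdsWithin_le_nhds ?_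
    refine (continuous_id.mul continuous_const).continuousAt.eventually_lt
      continuousAt_const ?_
    have := hlt l
    rw [lt_div_iff₀ hR] at this
    simpa [mul_comm] using this
  obtain ⟨s, hs, hsR⟩ := (hnear.and self_mem_nhdsWithin).exists
  obtain ⟨q, hq, hqs⟩ := hw (show s • p ∈ _ from fun l => by
    rw [real_inner_smul_left]
    exact (hs l).le)
  have h : ⟪R • q, y⟫ = ⟪s • p, y⟫ := congrArg (fun v => ⟪v, y⟫) hqs
  rw [real_inner_smul_left, real_inner_smul_left, hp, mul_one] at h
  have hRs : R < s := hsR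
  nlinarith [hK q hq]

theorem facet_lower_bound_criterion
    {n m : ℕ} (y : Fin m → EuclideanSpace ℝ (Fin n))
    (L : Set (EuclideanSpace ℝ (Fin n))) (hL : IsConvexBody L) (h0 : 0 ∈ interior L)
    (K : Set (EuclideanSpace ℝ (Fin n)))
    (hK : K = {x | ∀ i, ⟪x, y i⟫ ≤ 1} ∩ L)
    (R : ℝ) (hR : 1 < R)
    (x : Fin m → EuclideanSpace ℝ (Fin n))
    (hxK : ∀ i, x i ∈ K)
    (hxy : ∀ i, ⟪x i, y i⟫ = 1)
    (hxy' : ∀ i j, i ≠ j → ⟪x i, y j⟫ ≤ 1 / (2 * R))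
    (hxL : ∀ i, ∀ z ∈ polarSet L, ⟪x i, z⟫ ≤ 1 / (2 * R)) :
    ∀ (m₁ : ℕ) (w : Fin m₁ → EuclideanSpace ℝ (Fin n)),
      K ⊆ {x | ∀ l, ⟪x, w l⟫ ≤ 1} →
      {x : EuclideanSpace ℝ (Fin n) | ∀ l, ⟪x, w l⟫ ≤ 1} ⊆ R • K →
      (m₁ : ℝ) ≥ m / (2 * R) := by
  intro m₁ w hKw hwK
  subst hK
  have hR0 : 0 < R := by linarith
  choose l hl using fun i => exists_inv_le_inner hR0 hwK (fun v hv => hv.1 i) (hxy i)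
  have hcard (k : Fin m₁) : ((Finset.univ.filter fun i => l i = k).card : ℝ) ≤ 2 * R := by
    refine card_le_of_inv_le_inner hL.2.1 hL.1.isClosed (interior_subset h0) hR0 hxy hxy' hxL
      (fun v hv => hKw hv k) _ fun i hi => ?_
    rw [← (Finset.mem_filter.mp hi).2]
    exact hl i
  have hsum : (m : ℝ) = ∑ k, ((Finset.univ.filter fun i => l i = k).card : ℝ) := by
    rw [← Nat.cast_sum, ← Finset.card_eq_sum_card_fiberwise fun i _ => Finset.mem_univ (l i),
      Finset.card_univ, Fintype.card_fin]
  rw [ge_iff_le, div_le_iff₀ (by positivity), hsum]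
  simpa using Finset.sum_le_card_nsmul Finset.univ _ _ fun k _ => hcard k
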